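/- There is a constant C > 0, depending only on |𝒴|, with the following property. Let 𝒳 and 𝒴 be finite sets with |𝒳| ≥ 2 and |𝒴| ≥ 2, let n ≥ 27, let P be a probability mass function on 𝒳^n, let W ∈ 𝒫(𝒴|𝒳), let 𝐗 ∼ P and let 𝐘 be an output of 𝐗 through W^n. Then for every α ∈ (log₂(n)/n, 1/(8 ln 2)) there exist a set A† ⊆ 𝒳^n with P(A†) ≥ (1/n)·log₂(n/8), a real number δ ∈ (0, C·√α·(−log₂ α)], and a real number r ∈ [0, 2n·log₂|𝒴|), such that for every finitely supported random variable U jointly distributed with (𝐗,𝐘) satisfying U ⊸ 𝐗 ⊸ 𝐘, and every value u with P(U=u) > 0 and P(𝐗 ∈ A† | U=u) = 1, one has Pr(|h(𝐘|U) − r| > nδ + h_U(u) | U=u) < 3·2^{−nα}. -/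

import Mathlib

open scoped Classical BigOperators

noncomputable section

namespace Paper

variable {Ω : Type*}

/-- Probability of an event under a discrete probability distribution. -/
def pr (μ : PMF Ω) (E : Set Ω) : ℝ := (μ.toOuterMeasure E).toReal

/-- Conditional probability `Pr(E | F)`. -/
def cpr (μ : PMF Ω) (E F : Set Ω) : ℝ := pr μ (E ∩ F) / pr μ F

/-- Entropy spectrum frequency `h_X(x) = -log₂ Pr(X = x)`. -/
def hs {α : Type*} (μ : PMF Ω) (X : Ω → α) (x : α) : ℝ :=
  - Real.logb 2 (pr μ {ω | X ω = x})

/-- Conditional entropy spectrum frequency `h_{X|Y}(x|y) = -log₂ Pr(X = x | Y = y)`. -/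
def hcs {α β : Type*} (μ : PMF Ω) (X : Ω → α) (Y : Ω → β) (x : α) (y : β) : ℝ :=
  - Real.logb 2 (cpr μ {ω | X ω = x} {ω | Y ω = y})

/-- Conditional Shannon entropy (bits) `H(X|Y)`. -/
def Hc {α β : Type*} [Fintype α] [Fintype β] (μ : PMF Ω) (X : Ω → α) (Y : Ω → β) : ℝ :=
  - ∑ x : α, ∑ y : β, pr μ ({ω | X ω = x} ∩ {ω | Y ω = y}) *
      Real.logb 2 (cpr μ {ω | X ω = x} {ω | Y ω = y})

/-- Shannon entropy (bits) of `X` conditioned on the event `E`. -/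
def HEvt {α : Type*} [Fintype α] (μ : PMF Ω) (X : Ω → α) (E : Set Ω) : ℝ :=
  - ∑ x : α, cpr μ {ω | X ω = x} E * Real.logb 2 (cpr μ {ω | X ω = x} E)

/-- Conditional Shannon entropy (bits) `H(X|Y)` computed given the event `E`. -/
def HcEvt {α β : Type*} [Fintype α] [Fintype β] (μ : PMF Ω) (X : Ω → α) (Y : Ω → β)
    (E : Set Ω) : ℝ :=
  - ∑ x : α, ∑ y : β, cpr μ ({ω | X ω = x} ∩ {ω | Y ω = y}) E *
      Real.logb 2 (cpr μ {ω | X ω = x} ({ω | Y ω = y} ∩ E))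

/-- `A ⊸ B ⊸ C` : `A` and `C` are conditionally independent given `B`. -/
def Markov {α β γ : Type*} (μ : PMF Ω) (A : Ω → α) (B : Ω → β) (C : Ω → γ) : Prop :=
  ∀ a b c, pr μ {ω | A ω = a ∧ B ω = b ∧ C ω = c} * pr μ {ω | B ω = b} =
    pr μ {ω | A ω = a ∧ B ω = b} * pr μ {ω | B ω = b ∧ C ω = c}

/-- A discrete memoryless channel from `𝒳` to `𝒴`. -/
structure Channel (𝒳 𝒴 : Type*) [Fintype 𝒴] where
  w : 𝒳 → 𝒴 → ℝ
  nonneg : ∀ x y, 0 ≤ w x y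
  sum_one : ∀ x, ∑ y, w x y = 1

/-- The `n`-fold product channel `W^n(𝐲|𝐱)`. -/
def Channel.pn {𝒳 𝒴 : Type*} [Fintype 𝒴] (W : Channel 𝒳 𝒴) (n : ℕ)
    (x : Fin n → 𝒳) (y : Fin n → 𝒴) : ℝ := ∏ i, W.w (x i) (y i)

/-- `Y` is an output of `X` through `W^n`. -/
def IsOutput {𝒳 𝒴 : Type*} [Fintype 𝒴] {n : ℕ} (μ : PMF Ω)
    (X : Ω → Fin n → 𝒳) (Y : Ω → Fin n → 𝒴) (W : Channel 𝒳 𝒴) : Prop :=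
  ∀ x y, 0 < pr μ {ω | X ω = x} → cpr μ {ω | Y ω = y} {ω | X ω = x} = W.pn n x y

/-- `W^n(B|𝐱)`. -/
def imgMass {𝒳 𝒴 : Type*} [Fintype 𝒴] (W : Channel 𝒳 𝒴) (n : ℕ)
    (x : Fin n → 𝒳) (B : Finset (Fin n → 𝒴)) : ℝ := ∑ y ∈ B, W.pn n x y

/-- `B` is an `η`-image of `A` by `W`. -/
def IsImage {𝒳 𝒴 : Type*} [Fintype 𝒴] (W : Channel 𝒳 𝒴) (n : ℕ)
    (A : Set (Fin n → 𝒳)) (η : ℝ) (B : Finset (Fin n → 𝒴)) : Prop :=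
  ∀ x ∈ A, η ≤ imgMass W n x B

/-- Minimum cardinality of an `η`-image of `A` by `W`. -/
def gimg {𝒳 𝒴 : Type*} [Fintype 𝒴] (W : Channel 𝒳 𝒴) (n : ℕ)
    (A : Set (Fin n → 𝒳)) (η : ℝ) : ℕ :=
  sInf {k | ∃ B : Finset (Fin n → 𝒴), IsImage W n A η B ∧ B.card = k}

/-- `B` is an `η`-quasi-image of the pmf `P` by `W`. -/
def IsQImage {𝒳 𝒴 : Type*} [Fintype 𝒳] [Fintype 𝒴] (W : Channel 𝒳 𝒴) (n : ℕ)
    (P : (Fin n → 𝒳) → ℝ) (η : ℝ) (B : Finset (Fin n → 𝒴)) : Prop :=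
  η ≤ ∑ x, imgMass W n x B * P x

/-- Minimum cardinality of an `η`-quasi-image of `P` by `W`. -/
def gqimg {𝒳 𝒴 : Type*} [Fintype 𝒳] [Fintype 𝒴] (W : Channel 𝒳 𝒴) (n : ℕ)
    (P : (Fin n → 𝒳) → ℝ) (η : ℝ) : ℕ :=
  sInf {k | ∃ B : Finset (Fin n → 𝒴), IsQImage W n P η B ∧ B.card = k}

/-- The number of values in the support of `U`. -/
def suppCard {α : Type*} [Fintype α] (μ : PMF Ω) (U : Ω → α) : ℕ :=
  (Finset.univ.filter (fun u => 0 < pr μ {ω | U ω = u})).card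

/-- Mutual information (bits). -/
def MI {α β : Type*} [Fintype α] [Fintype β] (μ : PMF Ω) (A : Ω → α) (B : Ω → β) : ℝ :=
  ∑ a : α, ∑ b : β, pr μ {ω | A ω = a ∧ B ω = b} *
    Real.logb 2 (pr μ {ω | A ω = a ∧ B ω = b} / (pr μ {ω | A ω = a} * pr μ {ω | B ω = b}))

/-- Conditional mutual information (bits). -/
def CMI {α β γ : Type*} [Fintype α] [Fintype β] [Fintype γ] (μ : PMF Ω)
    (A : Ω → α) (B : Ω → β) (C : Ω → γ) : ℝ :=
  ∑ c : γ, pr μ {ω | C ω = c} * ∑ a : α, ∑ b : β,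
    cpr μ {ω | A ω = a ∧ B ω = b} {ω | C ω = c} *
      Real.logb 2 (cpr μ {ω | A ω = a ∧ B ω = b} {ω | C ω = c} /
        (cpr μ {ω | A ω = a} {ω | C ω = c} * cpr μ {ω | B ω = b} {ω | C ω = c}))

/-- `D_{wh}(w‖w'|p̂)` in the extended reals, with the stated conventions. -/
def Dkl {𝒳 𝒴 : Type*} [Fintype 𝒳] [Fintype 𝒴] (w w' wh : Channel 𝒳 𝒴)
    (p : 𝒳 → ℝ) : EReal :=
  if ∃ x y, 0 < wh.w x y * p x ∧ w'.w x y = 0 ∧ 0 < w.w x y then ⊤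
  else if ∃ x y, 0 < wh.w x y * p x ∧ w.w x y = 0 ∧ 0 < w'.w x y then ⊥
  else ((∑ x : 𝒳, ∑ y : 𝒴, wh.w x y * p x * Real.logb 2 (w.w x y / w'.w x y) : ℝ) : EReal)

/-- `sup { D_{wh}(w‖w'|p̂) }` over channels `wh` and pmfs `p̂` on `𝒳`. -/
def DklSup {𝒳 𝒴 : Type*} [Fintype 𝒳] [Fintype 𝒴] (w w' : Channel 𝒳 𝒴) : EReal :=
  sSup {d : EReal | ∃ (wh : Channel 𝒳 𝒴) (p : 𝒳 → ℝ),
    (∀ x, 0 ≤ p x) ∧ (∑ x, p x = 1) ∧ d = Dkl w w' wh p}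

section Concentration

/-- Two-point symmetrisation: if `F` varies by a factor at most `exp t` and `F * G ≤ M` pointwise,
then the product of the averages of `F` and `G` is at most `M * cosh t`. -/
lemma sum_mul_sum_le_mul_cosh {ι : Type*} [Fintype ι] {w F G : ι → ℝ} {M t : ℝ}
    (hw : ∀ a, 0 ≤ w a) (hw1 : ∑ a, w a = 1) (hF : ∀ a, 0 < F a)
    (hFF : ∀ a b, F a ≤ Real.exp t * F b) (hM0 : 0 ≤ M)
    (hM : ∀ a, F a * G a ≤ M) :
    (∑ a, w a * F a) * (∑ a, w a * G a) ≤ M * Real.cosh t := by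
  have key : ∀ a b, F a * G b + F b * G a ≤ 2 * (M * Real.cosh t) := by
    intro a b
    have hc : Real.exp t + Real.exp (-t) = 2 * Real.cosh t := by rw [Real.cosh_eq]; ring
    have he : Real.exp t * Real.exp (-t) = 1 := by rw [← Real.exp_add]; simp
    have h1 := hFF a b
    have h2 : Real.exp (-t) * F b ≤ F a := by
      calc Real.exp (-t) * F b ≤ Real.exp (-t) * (Real.exp t * F a) := by gcongr; exact hFF b a
        _ = F a := by rw [← mul_assoc, mul_comm (Real.exp (-t)), he, one_mul]
    have h3 : F a ^ 2 + F b ^ 2 ≤ 2 * Real.cosh t * (F a * F b) := by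
      rw [← hc]
      have := mul_nonneg (sub_nonneg.2 h1) (sub_nonneg.2 h2)
      have h4 : (Real.exp t * F b - F a) * (F a - Real.exp (-t) * F b)
        = (Real.exp t + Real.exp (-t)) * (F a * F b) - F a ^ 2
          - (Real.exp t * Real.exp (-t)) * F b ^ 2 := by ring
      rw [h4, he] at this
      linarith
    refine le_of_mul_le_mul_left ?_ (mul_pos (hF a) (hF b))
    have e1 := mul_le_mul_of_nonneg_left (hM b) (sq_nonneg (F a))
    have e2 := mul_le_mul_of_nonneg_left (hM a) (sq_nonneg (F b))
    have e3 := mul_le_mul_of_nonneg_left h3 hM0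
    nlinarith
  have hl : (∑ a, w a * F a) * (∑ a, w a * G a)
      = ∑ a, ∑ b, w a * w b * (F a * G b) := by
    rw [Finset.sum_mul_sum]
    exact Finset.sum_congr rfl fun a _ => Finset.sum_congr rfl fun b _ => by ring
  have hl' : (∑ a, w a * F a) * (∑ a, w a * G a)
      = ∑ a, ∑ b, w a * w b * (F b * G a) := by
    rw [hl, Finset.sum_comm]
    exact Finset.sum_congr rfl fun a _ => Finset.sum_congr rfl fun b _ => by ring
  have hsum : ∑ a, ∑ b, w a * w b * (F a * G b + F b * G a)
      ≤ ∑ a, ∑ b, w a * w b * (2 * (M * Real.cosh t)) :=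
    Finset.sum_le_sum fun a _ => Finset.sum_le_sum fun b _ =>
      mul_le_mul_of_nonneg_left (key a b) (mul_nonneg (hw a) (hw b))
  have hr : ∑ a, ∑ b, w a * w b * (2 * (M * Real.cosh t)) = 2 * (M * Real.cosh t) := by
    simp_rw [← Finset.sum_mul, ← Finset.mul_sum, hw1, mul_one, hw1, one_mul]
  simp_rw [mul_add, Finset.sum_add_distrib] at hsum
  rw [hr, ← hl, ← hl'] at hsum
  linarith

lemma prod_sum_eq_sum_prod {β : Type*} [Fintype β] {n : ℕ} (w : Fin n → β → ℝ) :
    ∏ i, ∑ a, w i a = ∑ y : Fin n → β, ∏ i, w i (y i) := by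
  rw [Finset.prod_univ_sum, Fintype.piFinset_univ]

lemma sum_prod_succ {β : Type*} [Fintype β] {n : ℕ} (w : Fin (n + 1) → β → ℝ)
    (g : (Fin (n + 1) → β) → ℝ) :
    ∑ y, (∏ i, w i (y i)) * g y
      = ∑ a, w 0 a * ∑ y : Fin n → β, (∏ i, w i.succ (y i)) * g (Fin.cons a y) := by
  rw [← (Fin.consEquiv fun _ => β).sum_comp, Fintype.sum_prod_type]
  refine Finset.sum_congr rfl fun a _ => ?_
  rw [Finset.mul_sum]
  refine Finset.sum_congr rfl fun y _ => ?_
  simp [Fin.consEquiv, Fin.prod_univ_succ, mul_assoc]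

lemma hammingDist_cons_cons_left {β : Type*} {n : ℕ} (a : β) (y z : Fin n → β) :
    hammingDist (Fin.cons a y : Fin (n + 1) → β) (Fin.cons a z) = hammingDist y z := by
  simp [hammingDist, Finset.card_filter, Fin.sum_univ_succ]

lemma hammingDist_cons_cons_right_le {β : Type*} {n : ℕ} (a b : β) (y : Fin n → β) :
    hammingDist (Fin.cons a y : Fin (n + 1) → β) (Fin.cons b y) ≤ 1 := by
  simp only [hammingDist, Finset.card_filter, Fin.sum_univ_succ]
  simp
  split_ifs <;> simp

/-- A function that is `1`-Lipschitz for the Hamming distance has exponential moments bounded by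
`cosh t ^ n` under a product distribution, in symmetrised form. -/
lemma exp_moment_mul_le_cosh_pow {β : Type*} [Fintype β] {t : ℝ} (ht : 0 ≤ t) {n : ℕ}
    (w : Fin n → β → ℝ) (f : (Fin n → β) → ℝ) (hw : ∀ i a, 0 ≤ w i a)
    (hw1 : ∀ i, ∑ a, w i a = 1) (hf : ∀ y z, f y ≤ f z + hammingDist y z) :
    (∑ y, (∏ i, w i (y i)) * Real.exp (t * f y))
      * (∑ y, (∏ i, w i (y i)) * Real.exp (-(t * f y))) ≤ Real.cosh t ^ n := by
  induction n with
  | zero => simp [← Real.exp_add]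
  | succ n ih =>
    rw [sum_prod_succ w fun y => Real.exp (t * f y),
      sum_prod_succ w fun y => Real.exp (-(t * f y)), pow_succ]
    have hpos : ∀ y : Fin n → β, 0 ≤ ∏ i : Fin n, w i.succ (y i) :=
      fun y => Finset.prod_nonneg fun i _ => hw _ _
    have hone : ∑ y : Fin n → β, ∏ i : Fin n, w i.succ (y i) = 1 := by
      simp [← prod_sum_eq_sum_prod fun i : Fin n => w i.succ, hw1]
    refine sum_mul_sum_le_mul_cosh (hw 0) (hw1 0) (fun a => ?_) (fun a b => ?_)
      (pow_nonneg (Real.cosh_pos t).le n) fun a => ?_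
    · obtain ⟨y, -, hy⟩ := Finset.exists_lt_of_sum_lt (s := Finset.univ)
        (f := fun _ : Fin n → β => (0 : ℝ)) (g := fun y => ∏ i : Fin n, w i.succ (y i))
        (by simp [hone])
      exact Finset.sum_pos' (fun y _ => mul_nonneg (hpos y) (Real.exp_pos _).le)
        ⟨y, Finset.mem_univ _, mul_pos hy (Real.exp_pos _)⟩
    · rw [Finset.mul_sum]
      refine Finset.sum_le_sum fun y _ => ?_
      rw [mul_left_comm, ← Real.exp_add]
      refine mul_le_mul_of_nonneg_left (Real.exp_le_exp.2 ?_) (hpos y)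
      have h1 := hf (Fin.cons a y) (Fin.cons b y)
      have h2 : (hammingDist (Fin.cons a y : Fin (n + 1) → β) (Fin.cons b y) : ℝ) ≤ 1 := by
        exact_mod_cast hammingDist_cons_cons_right_le a b y
      nlinarith
    · refine ih (fun i => w i.succ) (fun y => f (Fin.cons a y)) (fun i => hw _) (fun i => hw1 _) ?_
      intro y z
      rw [← hammingDist_cons_cons_left a y z]
      exact hf _ _

variable {𝒳 𝒴 : Type*} [Fintype 𝒴]

/-- The blow-up of radius `l` of `B` in the Hamming distance. -/
def blowUp {n : ℕ} (B : Finset (Fin n → 𝒴)) (l : ℝ) : Finset (Fin n → 𝒴) :=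
  Finset.univ.filter fun y => ∃ b ∈ B, (hammingDist y b : ℝ) ≤ l

lemma Channel.pn_nonneg (W : Channel 𝒳 𝒴) (n : ℕ) (x : Fin n → 𝒳) (y : Fin n → 𝒴) :
    0 ≤ W.pn n x y := Finset.prod_nonneg fun _ _ => W.nonneg _ _

lemma Channel.sum_pn (W : Channel 𝒳 𝒴) (n : ℕ) (x : Fin n → 𝒳) : ∑ y, W.pn n x y = 1 := by
  simp only [Channel.pn]
  simp [← prod_sum_eq_sum_prod fun i => W.w (x i), W.sum_one]

/-- Blowing-up lemma. -/
lemma imgMass_compl_blowUp_le (W : Channel 𝒳 𝒴) (n : ℕ) (x : Fin n → 𝒳)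
    (B : Finset (Fin n → 𝒴)) {α : ℝ} (hα : 0 ≤ α)
    (hB : (2 : ℝ) ^ (-(n : ℝ) * α) ≤ imgMass W n x B) :
    imgMass W n x (blowUp B (2 * n * Real.sqrt α))ᶜ ≤ (2 : ℝ) ^ (-(n : ℝ) * α) := by
  have hBne : B.Nonempty := by
    rw [Finset.nonempty_iff_ne_empty]
    rintro rfl
    simp only [imgMass, Finset.sum_empty] at hB
    exact absurd hB (not_le.2 (by positivity))
  set f : (Fin n → 𝒴) → ℝ := fun y => B.inf' hBne fun b => (hammingDist y b : ℝ) with hf_def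
  have hf : ∀ y z, f y ≤ f z + hammingDist y z := by
    intro y z
    obtain ⟨b, hb, hbz⟩ := Finset.exists_mem_eq_inf' hBne fun b => (hammingDist z b : ℝ)
    have h1 : f y ≤ hammingDist y b := Finset.inf'_le _ hb
    have h2 : (hammingDist y b : ℝ) ≤ hammingDist y z + hammingDist z b := by
      exact_mod_cast hammingDist_triangle y z b
    have h3 : f z = hammingDist z b := hbz
    linarith
  set t : ℝ := 2 * Real.sqrt α with ht_def
  have ht : 0 ≤ t := by positivity
  have hmain := exp_moment_mul_le_cosh_pow ht (fun i => W.w (x i)) f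
    (fun i a => W.nonneg _ _) (fun i => W.sum_one _) hf
  change (∑ y, W.pn n x y * Real.exp (t * f y))
      * (∑ y, W.pn n x y * Real.exp (-(t * f y))) ≤ Real.cosh t ^ n at hmain
  have hlow : imgMass W n x B ≤ ∑ y, W.pn n x y * Real.exp (-(t * f y)) := by
    calc imgMass W n x B ≤ ∑ y ∈ B, W.pn n x y * Real.exp (-(t * f y)) := by
          refine Finset.sum_le_sum fun y hy => ?_
          have h0 : f y ≤ 0 := by
            have : f y ≤ hammingDist y y := Finset.inf'_le _ hy
            simpa using this
          have : (1 : ℝ) ≤ Real.exp (-(t * f y)) := Real.one_le_exp (by nlinarith)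
          exact le_mul_of_one_le_right (W.pn_nonneg n x y) this
      _ ≤ _ := Finset.sum_le_univ_sum_of_nonneg fun y =>
          mul_nonneg (W.pn_nonneg n x y) (Real.exp_pos _).le
  set l : ℝ := 2 * n * Real.sqrt α with hl_def
  have hup : imgMass W n x (blowUp B l)ᶜ * Real.exp (t * l)
      ≤ ∑ y, W.pn n x y * Real.exp (t * f y) := by
    rw [imgMass, Finset.sum_mul]
    refine le_trans (Finset.sum_le_sum fun y hy => ?_) (Finset.sum_le_univ_sum_of_nonneg fun y =>
          mul_nonneg (W.pn_nonneg n x y) (Real.exp_pos _).le)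
    refine mul_le_mul_of_nonneg_left (Real.exp_le_exp.2 ?_) (W.pn_nonneg n x y)
    refine mul_le_mul_of_nonneg_left ?_ ht
    refine (Finset.le_inf'_iff _ _).2 fun b hb => ?_
    simp only [blowUp, Finset.mem_compl, Finset.mem_filter, Finset.mem_univ, true_and,
      not_exists, not_and, not_le] at hy
    exact (hy b hb).le
  have hcosh : Real.cosh t ^ n ≤ Real.exp (2 * n * α) := by
    calc Real.cosh t ^ n ≤ Real.exp (t ^ 2 / 2) ^ n :=
          pow_le_pow_left₀ (Real.cosh_pos t).le (Real.cosh_le_exp_half_sq t) n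
      _ = Real.exp (2 * n * α) := by
          rw [← Real.exp_nat_mul, ht_def, mul_pow, Real.sq_sqrt hα]
          congr 1; ring
  have htl : t * l = 4 * n * α := by
    have := Real.mul_self_sqrt hα
    rw [ht_def, hl_def]
    linear_combination 4 * (n : ℝ) * this
  set m := imgMass W n x (blowUp B l)ᶜ with hm_def
  have hm0 : 0 ≤ m := Finset.sum_nonneg fun y _ => W.pn_nonneg n x y
  have hlog : Real.log 2 ≤ 1 := by linarith [Real.log_two_lt_d9]
  have hε : (2 : ℝ) ^ (-(n : ℝ) * α) = Real.exp (-(Real.log 2 * (n * α))) := by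
    rw [Real.rpow_def_of_pos two_pos]; congr 1; ring
  have hprod : m * Real.exp (4 * n * α) * (2 : ℝ) ^ (-(n : ℝ) * α) ≤ Real.exp (2 * n * α) := by
    rw [htl] at hup
    calc m * Real.exp (4 * n * α) * (2 : ℝ) ^ (-(n : ℝ) * α)
        ≤ (∑ y, W.pn n x y * Real.exp (t * f y))
            * (∑ y, W.pn n x y * Real.exp (-(t * f y))) := by
          refine mul_le_mul hup (hB.trans hlow) (by positivity) ?_
          exact (mul_nonneg hm0 (Real.exp_pos _).le).trans hup
      _ ≤ _ := hmain.trans hcosh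
  rw [hε] at hprod ⊢
  have hnα : 0 ≤ n * α := by positivity
  have h5 : m ≤ Real.exp (2 * n * α - 4 * n * α + Real.log 2 * (n * α)) := by
    rw [mul_assoc, ← Real.exp_add] at hprod
    rw [← le_div_iff₀ (Real.exp_pos _), ← Real.exp_sub] at hprod
    refine hprod.trans (Real.exp_le_exp.2 ?_)
    linarith
  refine h5.trans (Real.exp_le_exp.2 ?_)
  nlinarith

lemma sum_pow_hammingDist_le {n : ℕ} (b : Fin n → 𝒴) {θ : ℝ} (hθ : 0 ≤ θ) :
    ∑ y, θ ^ hammingDist y b ≤ (1 + Fintype.card 𝒴 * θ) ^ n := by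
  have h := prod_sum_eq_sum_prod fun i a => if a ≠ b i then θ else 1
  have h2 : ∀ y, θ ^ hammingDist y b = ∏ i, if y i ≠ b i then θ else 1 := by
    intro y
    rw [hammingDist, Finset.prod_ite]
    simp
  simp_rw [h2]
  rw [← h]
  refine (Finset.prod_le_prod (fun i _ => Finset.sum_nonneg fun a _ => by split_ifs <;> simp [hθ])
    fun i _ => ?_).trans_eq (by rw [Finset.prod_const, Finset.card_univ, Fintype.card_fin])
  calc ∑ a, (if a ≠ b i then θ else 1) ≤ ∑ a, ((if a = b i then 1 else 0) + θ) := by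
        refine Finset.sum_le_sum fun a _ => ?_
        by_cases hab : a = b i <;> simp [hab, hθ]
    _ = 1 + Fintype.card 𝒴 * θ := by simp [Finset.sum_add_distrib]

lemma card_blowUp_le {n : ℕ} (B : Finset (Fin n → 𝒴)) {l θ : ℝ} (hθ : 0 < θ) (hθ1 : θ ≤ 1) :
    ((blowUp B l).card : ℝ) ≤ B.card * (θ ^ (-l) * Real.exp (n * (Fintype.card 𝒴 * θ))) := by
  have h1 : blowUp B l ⊆ B.biUnion fun b =>
      Finset.univ.filter fun y => (hammingDist y b : ℝ) ≤ l := by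
    intro y hy
    simpa [blowUp] using hy
  have h2 : ∀ b ∈ B, (((Finset.univ.filter fun y => (hammingDist y b : ℝ) ≤ l).card : ℕ) : ℝ)
      ≤ θ ^ (-l) * Real.exp (n * (Fintype.card 𝒴 * θ)) := by
    intro b _
    have h3 : ((Finset.univ.filter fun y => (hammingDist y b : ℝ) ≤ l).card : ℝ) * θ ^ l
        ≤ ∑ y, θ ^ hammingDist y b := by
      rw [← nsmul_eq_mul, ← Finset.sum_const]
      refine le_trans (Finset.sum_le_sum fun y hy => ?_)
        (Finset.sum_le_univ_sum_of_nonneg fun y => by positivity)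
      rw [← Real.rpow_natCast]
      exact Real.rpow_le_rpow_of_exponent_ge hθ hθ1 (Finset.mem_filter.1 hy).2
    have h4 : (1 + Fintype.card 𝒴 * θ) ^ n ≤ Real.exp (n * (Fintype.card 𝒴 * θ)) := by
      rw [Real.exp_nat_mul]
      refine pow_le_pow_left₀ (by positivity) ?_ n
      linarith [Real.add_one_le_exp (Fintype.card 𝒴 * θ)]
    have h5 := (h3.trans (sum_pow_hammingDist_le b hθ.le)).trans h4
    rw [Real.rpow_neg hθ.le, ← div_eq_inv_mul, le_div_iff₀ (by positivity)]
    exact h5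
  calc ((blowUp B l).card : ℝ) ≤ ((B.biUnion fun b =>
          Finset.univ.filter fun y => (hammingDist y b : ℝ) ≤ l).card : ℕ) := by
        exact_mod_cast Finset.card_le_card h1
    _ ≤ ∑ b ∈ B, (((Finset.univ.filter fun y => (hammingDist y b : ℝ) ≤ l).card : ℕ) : ℝ) := by
        exact_mod_cast Finset.card_biUnion_le
    _ ≤ ∑ b ∈ B, θ ^ (-l) * Real.exp (n * (Fintype.card 𝒴 * θ)) := Finset.sum_le_sum h2
    _ = _ := by rw [Finset.sum_const, nsmul_eq_mul]

lemma two_le_neg_logb {α : ℝ} (hα0 : 0 < α) (hα4 : α ≤ 1 / 4) : 2 ≤ -Real.logb 2 α := by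
  rw [le_neg, Real.logb_le_iff_le_rpow one_lt_two hα0, Real.rpow_neg two_pos.le]
  norm_num
  linarith

lemma card_blowUp_sqrt_le {n : ℕ} (B : Finset (Fin n → 𝒴)) {α : ℝ} (hα0 : 0 < α)
    (hα4 : α < 1 / 4) :
    ((blowUp B (2 * n * Real.sqrt α)).card : ℝ)
      ≤ B.card * 2 ^ (n * ((1 + Fintype.card 𝒴) * Real.sqrt α * -Real.logb 2 α)) := by
  have hs0 : 0 < Real.sqrt α := Real.sqrt_pos.2 hα0
  have hs1 : Real.sqrt α ≤ 1 := Real.sqrt_le_one.2 (by linarith)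
  have hL := two_le_neg_logb hα0 hα4.le
  refine (card_blowUp_le B hs0 hs1).trans ?_
  have hpow : Real.sqrt α ^ (-(2 * n * Real.sqrt α))
      = (2 : ℝ) ^ (n * Real.sqrt α * -Real.logb 2 α) := by
    have h : Real.sqrt α = (2 : ℝ) ^ (Real.logb 2 α / 2) := by
      rw [div_eq_mul_one_div, Real.rpow_mul two_pos.le,
        Real.rpow_logb two_pos (by norm_num) hα0, Real.sqrt_eq_rpow]
    calc Real.sqrt α ^ (-(2 * n * Real.sqrt α))
        = ((2 : ℝ) ^ (Real.logb 2 α / 2)) ^ (-(2 * n * Real.sqrt α)) := by rw [← h]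
      _ = _ := by
        rw [← Real.rpow_mul two_pos.le]
        congr 1
        ring
  have hexp : Real.exp (n * (Fintype.card 𝒴 * Real.sqrt α))
      ≤ (2 : ℝ) ^ (n * (Fintype.card 𝒴 * Real.sqrt α) * -Real.logb 2 α) := by
    rw [Real.rpow_def_of_pos two_pos]
    refine Real.exp_le_exp.2 ?_
    have h1 : 1 ≤ Real.log 2 * -Real.logb 2 α := by nlinarith [Real.log_two_gt_d9]
    have h2 : 0 ≤ n * (Fintype.card 𝒴 * Real.sqrt α) := by positivity
    nlinarith
  rw [hpow]
  refine mul_le_mul_of_nonneg_left ?_ (Nat.cast_nonneg _)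
  refine (mul_le_mul_of_nonneg_left hexp (by positivity)).trans_eq ?_
  rw [← Real.rpow_add two_pos]
  congr 1
  ring

end Concentration

section Slicing

variable {ζ η : Type*} [Fintype ζ]

/-- The output distribution of the input distribution `P` through the kernel `V`. -/
def outDist (P : ζ → ℝ) (V : ζ → η → ℝ) (y : η) : ℝ := ∑ x, P x * V x y

lemma outDist_nonneg {P : ζ → ℝ} {V : ζ → η → ℝ} (hP : ∀ x, 0 ≤ P x) (hV : ∀ x y, 0 ≤ V x y)
    (y : η) : 0 ≤ outDist P V y :=
  Finset.sum_nonneg fun x _ => mul_nonneg (hP x) (hV x y)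

lemma sum_outDist (P : ζ → ℝ) (V : ζ → η → ℝ) (s : Finset η) :
    ∑ y ∈ s, outDist P V y = ∑ x, P x * ∑ y ∈ s, V x y := by
  simp_rw [outDist, Finset.mul_sum]
  exact Finset.sum_comm

/-- If every `x` in the support of `ν` gives mass at most `ε` to `s`, so does the output of `ν`. -/
lemma sum_outDist_le {ν : ζ → ℝ} {V : ζ → η → ℝ} {A : Set ζ} {ε : ℝ} (hν : ∀ x, 0 ≤ ν x)
    (hν1 : ∑ x, ν x = 1) (hνA : ∀ x, x ∉ A → ν x = 0) {s : Finset η}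
    (hs : ∀ x ∈ A, ∑ y ∈ s, V x y ≤ ε) : ∑ y ∈ s, outDist ν V y ≤ ε := by
  rw [sum_outDist]
  calc ∑ x, ν x * ∑ y ∈ s, V x y ≤ ∑ x, ν x * ε := by
        refine Finset.sum_le_sum fun x _ => ?_
        by_cases hx : x ∈ A
        · exact mul_le_mul_of_nonneg_left (hs x hx) (hν x)
        · simp [hνA x hx]
    _ = ε := by rw [← Finset.sum_mul, hν1, one_mul]

variable [Fintype η]

lemma sum_outDist_univ {P : ζ → ℝ} {V : ζ → η → ℝ} (hP1 : ∑ x, P x = 1)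
    (hV1 : ∀ x, ∑ y, V x y = 1) : ∑ y, outDist P V y = 1 := by
  simp [sum_outDist, hV1, hP1]

/-- The set of outputs of probability more than `2 ^ (-t)`. -/
def likely (Q : η → ℝ) (t : ℝ) : Finset η := Finset.univ.filter fun y => (2 : ℝ) ^ (-t) < Q y

lemma card_likely_le {Q : η → ℝ} (hQ : ∀ y, 0 ≤ Q y) (hQ1 : ∑ y, Q y = 1) (t : ℝ) :
    ((likely Q t).card : ℝ) ≤ 2 ^ t := by
  have h : ((likely Q t).card : ℝ) * 2 ^ (-t) ≤ 1 := by
    rw [← nsmul_eq_mul, ← Finset.sum_const, ← hQ1]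
    exact (Finset.sum_le_sum fun y hy => (Finset.mem_filter.1 hy).2.le).trans
      (Finset.sum_le_univ_sum_of_nonneg hQ)
  rw [Real.rpow_neg two_pos.le] at h
  rwa [← div_eq_mul_inv, div_le_one (by positivity)] at h

/-- Some set of inputs of probability at least `1 / (2 * K)` has its threshold `t`, at which
`likely (outDist P V) t` first receives mass `ε`, within a window of width `T / K`. -/
lemma exists_slice {P : ζ → ℝ} {V : ζ → η → ℝ} (hP : ∀ x, 0 ≤ P x) (hP1 : ∑ x, P x = 1)
    (hV : ∀ x y, 0 ≤ V x y) (hV1 : ∀ x, ∑ y, V x y = 1) {K : ℕ} (hK : 0 < K) {T ε : ℝ}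
    (hT : 0 ≤ T) (hcard : (Fintype.card η : ℝ) ≤ 2 ^ T / 4) (hε : 0 < ε) (hε2 : ε ≤ 1 / 2) :
    ∃ (A : Finset ζ) (r : ℝ), 0 ≤ r ∧ r ≤ T ∧ 1 / (2 * K : ℝ) ≤ ∑ x ∈ A, P x ∧
      (∀ x ∈ A, ε ≤ ∑ y ∈ likely (outDist P V) r, V x y) ∧
      ∀ x ∈ A, ∑ y ∈ likely (outDist P V) (r - T / K), V x y ≤ ε := by
  have hK' : (0 : ℝ) < K := by exact_mod_cast hK
  set Q := outDist P V with hQ_def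
  have hQ : ∀ y, 0 ≤ Q y := outDist_nonneg hP hV
  have hQ1 : ∑ y, Q y = 1 := sum_outDist_univ hP1 hV1
  let g : ζ → ℕ → ℝ := fun x k => ∑ y ∈ likely Q (k * (T / K)), V x y
  let A : ℕ → Finset ζ := fun k => Finset.univ.filter fun x => ε ≤ g x (k + 1) ∧ g x k ≤ ε
  have hg0 : ∀ x, g x 0 ≤ ε := by
    intro x
    have : likely Q (((0 : ℕ) : ℝ) * (T / K)) = ∅ := by
      refine Finset.filter_eq_empty_iff.2 fun y _ => ?_
      simp only [Nat.cast_zero, zero_mul, neg_zero, Real.rpow_zero, not_lt]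
      rw [← hQ1]
      exact Finset.single_le_sum (fun y _ => hQ y) (Finset.mem_univ y)
    simp only [g, this, Finset.sum_empty]
    exact hε.le
  have hTK : (K : ℝ) * (T / K) = T := by field_simp
  have hgood : 1 / 2 ≤ ∑ x ∈ Finset.univ.filter (fun x => ε ≤ g x K), P x := by
    have h1 : ∑ y ∈ (likely Q T)ᶜ, Q y ≤ 1 / 4 := by
      calc ∑ y ∈ (likely Q T)ᶜ, Q y ≤ ∑ y ∈ (likely Q T)ᶜ, (2 : ℝ) ^ (-T) := by
            refine Finset.sum_le_sum fun y hy => ?_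
            simpa [likely] using hy
        _ ≤ Fintype.card η * (2 : ℝ) ^ (-T) := by
            rw [Finset.sum_const, nsmul_eq_mul]
            gcongr
            exact Finset.card_le_univ _
        _ ≤ 2 ^ T / 4 * (2 : ℝ) ^ (-T) := by gcongr
        _ = 1 / 4 := by
            rw [Real.rpow_neg two_pos.le]
            have : (2 : ℝ) ^ T ≠ 0 := by positivity
            field_simp
    have h2 : ∀ x, ∑ y ∈ (likely Q T)ᶜ, V x y = 1 - g x K := by
      intro x
      rw [← hV1 x, ← Finset.sum_add_sum_compl (likely Q T)]
      simp only [g, hTK]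
      ring
    rw [sum_outDist] at h1
    simp_rw [h2] at h1
    have h3 : ∀ x, g x K ≤ 1 := by
      intro x
      rw [← hV1 x]
      exact Finset.sum_le_univ_sum_of_nonneg (hV x)
    have h4 : ∑ x ∈ Finset.univ.filter (fun x => ¬ ε ≤ g x K), P x * (1 / 2) ≤ 1 / 4 := by
      refine le_trans (Finset.sum_le_sum fun x hx => ?_) ((Finset.sum_le_univ_sum_of_nonneg
        fun x => mul_nonneg (hP x) (sub_nonneg.2 (h3 x))).trans h1)
      have := not_le.1 (Finset.mem_filter.1 hx).2
      exact mul_le_mul_of_nonneg_left (by linarith) (hP x)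
    rw [← Finset.sum_mul] at h4
    have h5 := Finset.sum_filter_add_sum_filter_not Finset.univ (fun x => ε ≤ g x K) P
    rw [hP1] at h5
    linarith
  have hcover : ∀ x, ε ≤ g x K → ∃ k ∈ Finset.range K, x ∈ A k := by
    intro x hx
    by_contra hcon
    simp only [A, Finset.mem_range, Finset.mem_filter, Finset.mem_univ, true_and, not_exists,
      not_and] at hcon
    have hlt : ∀ k < K, g x (k + 1) < ε := by
      intro k
      induction k with
      | zero => exact fun hk => by_contra fun h => hcon 0 hk (not_lt.1 h) (hg0 x)
      | succ k ih =>
        exact fun hk => by_contra fun h => hcon (k + 1) hk (not_lt.1 h) (ih (by omega)).le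
    have := hlt (K - 1) (by omega)
    rw [Nat.sub_add_cancel hK] at this
    linarith
  obtain ⟨k, hk, hkA⟩ : ∃ k ∈ Finset.range K, 1 / (2 * K : ℝ) ≤ ∑ x ∈ A k, P x := by
    refine Finset.exists_le_of_sum_le (by simpa using hK.ne') ?_
    rw [Finset.sum_const, Finset.card_range, nsmul_eq_mul]
    calc (K : ℝ) * (1 / (2 * K)) = 1 / 2 := by field_simp
      _ ≤ _ := hgood
      _ ≤ ∑ x, ∑ k ∈ Finset.range K, if x ∈ A k then P x else 0 := by
          have hite : ∀ x k, 0 ≤ if x ∈ A k then P x else 0 := fun x k => by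
            split_ifs; exacts [hP x, le_rfl]
          refine le_trans (Finset.sum_le_sum fun x hx => ?_) (Finset.sum_le_univ_sum_of_nonneg
            fun x => Finset.sum_nonneg fun k _ => hite x k)
          obtain ⟨k, hk, hkA⟩ := hcover x (Finset.mem_filter.1 hx).2
          calc P x = if x ∈ A k then P x else 0 := (if_pos hkA).symm
            _ ≤ _ := Finset.single_le_sum (fun k _ => hite x k) hk
      _ = ∑ k ∈ Finset.range K, ∑ x ∈ A k, P x := by
          rw [Finset.sum_comm]
          refine Finset.sum_congr rfl fun k _ => ?_
          rw [Finset.sum_ite_mem, Finset.univ_inter]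
  refine ⟨A k, ((k + 1 : ℕ) : ℝ) * (T / K), by positivity, ?_, hkA, fun x hx => ?_, fun x hx => ?_⟩
  · calc ((k + 1 : ℕ) : ℝ) * (T / K) ≤ K * (T / K) := by
          gcongr
          exact Finset.mem_range.1 hk
      _ = T := hTK
  · exact (Finset.mem_filter.1 hx).2.1
  · have h : ((k + 1 : ℕ) : ℝ) * (T / K) - T / K = k * (T / K) := by push_cast; ring
    rw [h]
    exact (Finset.mem_filter.1 hx).2.2

/-- The output of a distribution `ν ≤ P / p` carried by `A` has its entropy spectrum close to `r`
as soon as every input in `A` mostly avoids the outputs that are likely under `P` and is mostly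
mapped into the small set `S`. -/
lemma sum_spectrum_deviation_lt {P ν : ζ → ℝ} {V : ζ → η → ℝ} {A : Set ζ} {S : Finset η}
    {p r w D ε : ℝ} (hV : ∀ x y, 0 ≤ V x y) (hν : ∀ x, 0 ≤ ν x) (hν1 : ∑ x, ν x = 1)
    (hνA : ∀ x, x ∉ A → ν x = 0) (hp : 0 < p) (hp1 : p ≤ 1) (hνP : ∀ x, ν x * p ≤ P x)
    (hw : w ≤ D) (hS : ∀ x ∈ A, ∑ y ∈ Sᶜ, V x y ≤ ε)
    (hL : ∀ x ∈ A, ∑ y ∈ likely (outDist P V) (r - w), V x y ≤ ε)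
    (hcard : (S.card : ℝ) * 2 ^ (-(r + D)) < ε) :
    ∑ y ∈ Finset.univ.filter
      (fun y => D + -Real.logb 2 p < |-Real.logb 2 (outDist ν V y) - r|), outDist ν V y
      < 3 * ε := by
  set q := outDist ν V with hq_def
  have hq : ∀ y, 0 ≤ q y := outDist_nonneg hν hV
  have hsub : ∀ y ∈ Finset.univ.filter (fun y => D + -Real.logb 2 p < |-Real.logb 2 (q y) - r|),
      q y ≤ (if y ∈ Sᶜ then q y else 0) + (if y ∈ likely (outDist P V) (r - w) then q y else 0)
        + (if y ∈ S then (2 : ℝ) ^ (-(r + D)) else 0) := by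
    intro y hy
    have hc1 : 0 ≤ if y ∈ Sᶜ then q y else 0 := by split_ifs; exacts [hq y, le_rfl]
    have hc2 : 0 ≤ if y ∈ likely (outDist P V) (r - w) then q y else 0 := by
      split_ifs; exacts [hq y, le_rfl]
    have hc3 : 0 ≤ if y ∈ S then (2 : ℝ) ^ (-(r + D)) else 0 := by
      split_ifs; exacts [by positivity, le_rfl]
    rcases (hq y).eq_or_lt with h0 | h0
    · linarith
    by_cases hyS : y ∈ S
    swap
    · rw [if_pos (Finset.mem_compl.2 hyS)]
      linarith
    by_cases hyL : y ∈ likely (outDist P V) (r - w)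
    · rw [if_pos hyL]
      linarith
    rw [if_pos hyS]
    have hyL' : outDist P V y ≤ 2 ^ (-(r - w)) := by simpa [likely] using hyL
    have hqp : q y * p ≤ outDist P V y := by
      rw [hq_def, outDist, outDist, Finset.sum_mul]
      refine Finset.sum_le_sum fun x _ => ?_
      rw [mul_right_comm]
      exact mul_le_mul_of_nonneg_right (hνP x) (hV x y)
    have hlog : Real.logb 2 (q y) + Real.logb 2 p ≤ -(r - w) := by
      rw [← Real.logb_mul h0.ne' hp.ne']
      rw [Real.logb_le_iff_le_rpow one_lt_two (mul_pos h0 hp)]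
      exact hqp.trans hyL'
    have hlogp : Real.logb 2 p ≤ 0 := Real.logb_nonpos one_lt_two hp.le hp1
    have hq2 : Real.logb 2 (q y) ≤ -(r + D) := by
      rcases lt_abs.1 (Finset.mem_filter.1 hy).2 with h | h <;> linarith
    rw [Real.logb_le_iff_le_rpow one_lt_two h0] at hq2
    linarith
  have hsum := (Finset.sum_le_sum hsub).trans (Finset.sum_le_univ_sum_of_nonneg fun y => by
    have := hq y
    have : (0 : ℝ) ≤ 2 ^ (-(r + D)) := by positivity
    split_ifs <;> linarith)
  rw [Finset.sum_add_distrib, Finset.sum_add_distrib, Finset.sum_ite_mem, Finset.sum_ite_mem,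
    Finset.sum_ite_mem, Finset.univ_inter, Finset.univ_inter, Finset.univ_inter,
    Finset.sum_const, nsmul_eq_mul] at hsum
  have h1 := sum_outDist_le hν hν1 hνA hS
  have h2 := sum_outDist_le hν hν1 hνA hL
  linarith

end Slicing

section Probability

lemma pr_eq_sum_inter {ζ : Type*} [Fintype ζ] (μ : PMF Ω) (X : Ω → ζ) (E : Set Ω) :
    pr μ E = ∑ x, pr μ (E ∩ {ω | X ω = x}) := by
  let _ : MeasurableSpace Ω := ⊤
  have h : ∀ F : Set Ω, pr μ F = μ.toMeasure.real F := fun F => by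
    rw [pr, MeasureTheory.measureReal_def, PMF.toMeasure_apply_eq_toOuterMeasure]
  simp_rw [h]
  rw [← MeasureTheory.measureReal_iUnion_fintype]
  · congr 1
    ext ω
    simp
  · intro x x' hxx'
    refine Set.disjoint_left.2 fun ω h1 h2 => hxx' ?_
    rw [← h1.2, ← h2.2]
  · exact fun _ => trivial

lemma pr_nonneg (μ : PMF Ω) (E : Set Ω) : 0 ≤ pr μ E := ENNReal.toReal_nonneg

lemma pr_mono (μ : PMF Ω) {E F : Set Ω} (h : E ⊆ F) : pr μ E ≤ pr μ F := by
  let _ : MeasurableSpace Ω := ⊤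
  simp only [pr, ← PMF.toMeasure_apply_eq_toOuterMeasure]
  exact ENNReal.toReal_mono (MeasureTheory.measure_ne_top _ _) (MeasureTheory.measure_mono h)

lemma pr_univ (μ : PMF Ω) : pr μ Set.univ = 1 := by
  let _ : MeasurableSpace Ω := ⊤
  rw [pr, ← PMF.toMeasure_apply_eq_toOuterMeasure]
  simp

lemma pr_le_one (μ : PMF Ω) (E : Set Ω) : pr μ E ≤ 1 :=
  (pr_mono μ (Set.subset_univ E)).trans_eq (pr_univ μ)

lemma pr_empty (μ : PMF Ω) : pr μ ∅ = 0 := by simp [pr]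

lemma pr_inter_mem {ζ : Type*} [Fintype ζ] (μ : PMF Ω) (X : Ω → ζ) (s : Finset ζ) (E : Set Ω) :
    pr μ ({ω | X ω ∈ s} ∩ E) = ∑ x ∈ s, pr μ ({ω | X ω = x} ∩ E) := by
  rw [pr_eq_sum_inter μ X, ← Finset.sum_subset (Finset.subset_univ s)]
  · refine Finset.sum_congr rfl fun x hx => congrArg _ ?_
    ext ω
    simp only [Set.mem_inter_iff, Set.mem_ofPred_eq]
    constructor
    · rintro ⟨⟨-, h⟩, h'⟩
      exact ⟨h', h⟩
    · rintro ⟨rfl, h⟩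
      exact ⟨⟨hx, h⟩, rfl⟩
  · intro x _ hx
    rw [← pr_empty μ]
    congr 1
    ext ω
    simp only [Set.mem_inter_iff, Set.mem_ofPred_eq, Set.mem_empty_iff_false, iff_false]
    rintro ⟨⟨h, -⟩, rfl⟩
    exact hx h

variable {𝒳 𝒴 : Type*} [Fintype 𝒳] [Fintype 𝒴]

/-- Along a Markov chain `U ⊸ X ⊸ Y`, the conditional law of `Y` is the output through the product
channel of the conditional law of `X`. -/
lemma cpr_eq_outDist {𝒰 : Type*} {n : ℕ} {μ : PMF Ω} {W : Channel 𝒳 𝒴} {X : Ω → Fin n → 𝒳}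
    {Y : Ω → Fin n → 𝒴} {U : Ω → 𝒰} (hY : IsOutput μ X Y W) (hM : Markov μ U X Y) (u : 𝒰)
    (y : Fin n → 𝒴) :
    cpr μ {ω | Y ω = y} {ω | U ω = u}
      = outDist (fun x => cpr μ {ω | X ω = x} {ω | U ω = u}) (W.pn n) y := by
  rw [cpr, pr_eq_sum_inter μ X, outDist, Finset.sum_div]
  refine Finset.sum_congr rfl fun x _ => ?_
  have h1 := hM u x y
  have e1 : {ω | Y ω = y} ∩ {ω | U ω = u} ∩ {ω | X ω = x} = {ω | U ω = u ∧ X ω = x ∧ Y ω = y} := by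
    ext ω
    simp only [Set.mem_inter_iff, Set.mem_ofPred_eq]
    tauto
  have e2 : {ω | X ω = x} ∩ {ω | U ω = u} = {ω | U ω = u ∧ X ω = x} := by
    ext ω
    simp only [Set.mem_inter_iff, Set.mem_ofPred_eq]
    tauto
  rw [cpr, e1, e2, div_mul_eq_mul_div]
  congr 1
  rcases (pr_nonneg μ {ω | X ω = x}).eq_or_lt with h0 | h0
  · have hz : ∀ E ⊆ {ω | X ω = x}, pr μ E = 0 := fun E hE =>
      le_antisymm ((pr_mono μ hE).trans_eq h0.symm) (pr_nonneg μ E)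
    rw [hz _ fun ω h => h.2.1, hz _ fun ω h => h.2, zero_mul]
  · have h2 := hY x y h0
    have e3 : {ω | Y ω = y} ∩ {ω | X ω = x} = {ω | X ω = x ∧ Y ω = y} := by
      ext ω
      simp only [Set.mem_inter_iff, Set.mem_ofPred_eq]
      tauto
    rw [cpr, e3, div_eq_iff h0.ne'] at h2
    rw [h2, ← mul_assoc] at h1
    exact mul_right_cancel₀ (ne_of_gt h0) h1

/-- Probabilistic form of `sum_spectrum_deviation_lt`. -/
lemma cpr_spectrum_deviation_lt {𝒰 : Type*} {n : ℕ} {μ : PMF Ω} {W : Channel 𝒳 𝒴}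
    {X : Ω → Fin n → 𝒳} {Y : Ω → Fin n → 𝒴} {U : Ω → 𝒰} {P : (Fin n → 𝒳) → ℝ}
    (hOut : IsOutput μ X Y W) (hPX : ∀ x, pr μ {ω | X ω = x} = P x) (hM : Markov μ U X Y)
    {u : 𝒰} (hu : 0 < pr μ {ω | U ω = u}) {A : Finset (Fin n → 𝒳)}
    (hA : cpr μ {ω | X ω ∈ (A : Set (Fin n → 𝒳))} {ω | U ω = u} = 1)
    {S : Finset (Fin n → 𝒴)} {r w D ε : ℝ} (hw : w ≤ D)
    (hS : ∀ x ∈ A, ∑ y ∈ Sᶜ, W.pn n x y ≤ ε)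
    (hL : ∀ x ∈ A, ∑ y ∈ likely (outDist P (W.pn n)) (r - w), W.pn n x y ≤ ε)
    (hcard : (S.card : ℝ) * 2 ^ (-(r + D)) < ε) :
    cpr μ {ω | |hcs μ Y U (Y ω) (U ω) - r| > D + hs μ U u} {ω | U ω = u} < 3 * ε := by
  set p : ℝ := pr μ {ω | U ω = u} with hp_def
  set ν : (Fin n → 𝒳) → ℝ := fun x => cpr μ {ω | X ω = x} {ω | U ω = u} with hν_def
  have hν : ∀ x, 0 ≤ ν x := fun x => div_nonneg (pr_nonneg _ _) (pr_nonneg _ _)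
  have hν1 : ∑ x, ν x = 1 := by
    simp only [hν_def, cpr]
    rw [← Finset.sum_div, div_eq_one_iff_eq hu.ne', hp_def, pr_eq_sum_inter μ X]
    exact Finset.sum_congr rfl fun x _ => by rw [Set.inter_comm]
  have hνA : ∀ x, x ∉ (A : Set (Fin n → 𝒳)) → ν x = 0 := by
    intro x hx
    have h1 : ∑ x ∈ A, ν x = 1 := by
      rw [← hA]
      simp only [hν_def, cpr, Finset.mem_coe]
      rw [pr_inter_mem, Finset.sum_div]
    have h2 := Finset.sum_le_univ_sum_of_nonneg (s := insert x A) hν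
    rw [Finset.sum_insert (by simpa using hx)] at h2
    exact le_antisymm (by linarith) (hν x)
  have hνP : ∀ x, ν x * p ≤ P x := by
    intro x
    simp only [hν_def, cpr]
    rw [div_mul_cancel₀ _ hu.ne', ← hPX x]
    exact pr_mono μ Set.inter_subset_left
  have hmain := sum_spectrum_deviation_lt (A := A) (S := S) (W.pn_nonneg n) hν hν1 hνA hu
    (pr_le_one μ _) hνP hw
    (fun x hx => by convert hS x hx) hL hcard
  refine lt_of_eq_of_lt ?_ hmain
  have hcpr := cpr_eq_outDist hOut hM u
  have hset : {ω | |hcs μ Y U (Y ω) (U ω) - r| > D + hs μ U u} ∩ {ω | U ω = u}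
      = {ω | Y ω ∈ Finset.univ.filter fun y =>
          D + -Real.logb 2 p < |-Real.logb 2 (outDist ν (W.pn n) y) - r|}
        ∩ {ω | U ω = u} := by
    ext ω
    simp only [Set.mem_inter_iff, Set.mem_ofPred_eq, Finset.mem_filter, Finset.mem_univ, true_and]
    refine and_congr_left fun hω => ?_
    rw [hω, hcs, hcpr, hs, gt_iff_lt]
  rw [cpr, hset, pr_inter_mem, Finset.sum_div]
  exact Finset.sum_congr rfl fun y _ => hcpr y

end Probability

/-- Theorem `lem:daco`. -/
theorem exists_stable_subset (c𝒴 : ℕ) :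
    ∃ C : ℝ, 0 < C ∧
      ∀ (𝒳 𝒴 : Type) [Fintype 𝒳] [Fintype 𝒴], Fintype.card 𝒴 = c𝒴 →
      2 ≤ Fintype.card 𝒳 → 2 ≤ Fintype.card 𝒴 →
      ∀ (n : ℕ), 27 ≤ n →
      ∀ (Ω : Type) (μ : PMF Ω) (P : (Fin n → 𝒳) → ℝ) (W : Channel 𝒳 𝒴)
        (X : Ω → Fin n → 𝒳) (Y : Ω → Fin n → 𝒴),
        (∀ x, 0 ≤ P x) → (∑ x, P x = 1) →
        (∀ x, pr μ {ω | X ω = x} = P x) →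
        IsOutput μ X Y W →
      ∀ α : ℝ, Real.logb 2 n / n < α → α < 1 / (8 * Real.log 2) →
      ∃ (A : Set (Fin n → 𝒳)) (δ r : ℝ),
        (1 / n) * Real.logb 2 ((n : ℝ) / 8) ≤ pr μ {ω | X ω ∈ A} ∧
        0 < δ ∧ δ ≤ C * Real.sqrt α * (- Real.logb 2 α) ∧
        0 ≤ r ∧ r < 2 * n * Real.logb 2 (Fintype.card 𝒴) ∧
        ∀ (𝒰 : Type) [Fintype 𝒰], ∀ (U : Ω → 𝒰),
          Markov μ U X Y →
          ∀ u : 𝒰, 0 < pr μ {ω | U ω = u} →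
            cpr μ {ω | X ω ∈ A} {ω | U ω = u} = 1 →
            cpr μ {ω | |hcs μ Y U (Y ω) (U ω) - r| > n * δ + hs μ U u}
                {ω | U ω = u} < 3 * 2 ^ (-(n : ℝ) * α) := by
  refine ⟨2 * c𝒴 + 2, by positivity, ?_⟩
  intro 𝒳 𝒴 _ _ hc𝒴 _ hY2 n hn Ω μ P W X Y hP hP1 hPX hOut α hα hα'
  subst hc𝒴
  set q : ℕ := Fintype.card 𝒴 with hq_def
  have hq : (2 : ℝ) ≤ q := by exact_mod_cast hY2
  have hn' : (27 : ℝ) ≤ n := by exact_mod_cast hn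
  have hn0 : (0 : ℝ) < n := by linarith
  have hlogn : 1 ≤ Real.logb 2 n := by
    rw [Real.le_logb_iff_rpow_le one_lt_two hn0, Real.rpow_one]
    linarith
  have hα0 : 0 < α := lt_trans (by positivity) hα
  have hα4 : α < 1 / 4 := by
    refine hα'.trans_le (one_div_le_one_div_of_le (by norm_num) ?_)
    linarith [Real.log_two_gt_d9]
  have hnα : Real.logb 2 n < n * α := by
    rw [div_lt_iff₀ hn0] at hα
    linarith
  set s : ℝ := Real.sqrt α with hs_def
  set L : ℝ := -Real.logb 2 α with hL_def
  have hs0 : 0 < s := Real.sqrt_pos.2 hα0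
  have hss : s * s = α := Real.mul_self_sqrt hα0.le
  have hs2 : s ≤ 1 / 2 := by nlinarith
  have hL2 : 2 ≤ L := two_le_neg_logb hα0 hα4.le
  have hlogq : 1 ≤ Real.logb 2 q := by
    rw [Real.le_logb_iff_rpow_le one_lt_two (by linarith), Real.rpow_one]
    exact hq
  have hlogq' : Real.logb 2 q ≤ q := by
    rw [Real.logb_le_iff_le_rpow one_lt_two (by linarith), Real.rpow_natCast]
    exact_mod_cast Nat.lt_two_pow_self.le
  set δ : ℝ := (2 * q + 2) * s * L with hδ_def
  set ε : ℝ := 2 ^ (-(n : ℝ) * α) with hε_def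
  have hε0 : 0 < ε := by positivity
  have hε2 : ε ≤ 1 / 2 := by
    calc ε ≤ (2 : ℝ) ^ (-1 : ℝ) := Real.rpow_le_rpow_of_exponent_le one_le_two (by linarith)
      _ = 1 / 2 := by rw [Real.rpow_neg_one]; norm_num
  set K : ℕ := ⌊1 / s⌋₊ with hK_def
  have hs_inv : 2 ≤ 1 / s := by
    rw [le_div_iff₀ hs0]
    linarith
  have hK : 0 < K := Nat.floor_pos.2 (by linarith)
  have hK0 : (0 : ℝ) < K := by exact_mod_cast hK
  have hKle : K * s ≤ 1 := by
    have := Nat.floor_le (one_div_pos.2 hs0).le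
    rwa [le_div_iff₀ hs0] at this
  have hKge : 1 ≤ 2 * s * K := by
    have h1 : 1 / s < K + 1 := Nat.lt_floor_add_one _
    rw [div_lt_iff₀ hs0] at h1
    linarith
  set T : ℝ := n * Real.logb 2 q + 2 with hT_def
  have hT : T < 2 * n * Real.logb 2 q := by nlinarith
  have hTcard : (Fintype.card (Fin n → 𝒴) : ℝ) ≤ 2 ^ T / 4 := by
    rw [hT_def, Real.rpow_add two_pos, mul_comm (n : ℝ), Real.rpow_mul two_pos.le,
      Real.rpow_logb two_pos (by norm_num) (by linarith), Real.rpow_natCast]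
    simp only [Fintype.card_fun, Fintype.card_fin, ← hq_def, Nat.cast_pow]
    norm_num
  obtain ⟨A, r, hr0, hrT, hPA, hAup, hAlow⟩ := exists_slice (V := W.pn n) hP hP1
    (W.pn_nonneg n) (W.sum_pn n) hK (by positivity) hTcard hε0 hε2
  refine ⟨A, δ, r, ?_, by positivity, le_rfl, hr0, hrT.trans_lt hT, ?_⟩
  · have h1 : pr μ {ω | X ω ∈ (A : Set (Fin n → 𝒳))} = ∑ x ∈ A, P x := by
      have := pr_inter_mem μ X A Set.univ
      simp only [Set.inter_univ] at this
      simpa only [Finset.mem_coe, hPX] using this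
    rw [h1]
    refine le_trans ?_ hPA
    have h2 : Real.logb 2 ((n : ℝ) / 8) ≤ Real.logb 2 n :=
      Real.logb_le_logb_of_le one_lt_two (by positivity) (by linarith)
    have h3 : 1 / (n : ℝ) * Real.logb 2 ((n : ℝ) / 8) ≤ α := by
      rw [one_div, inv_mul_le_iff₀ hn0]
      linarith
    refine h3.trans ?_
    rw [le_div_iff₀ (by positivity), ← hss]
    nlinarith
  intro 𝒰 _ U hM u hu hA
  set B := likely (outDist P (W.pn n)) r with hB_def
  set S := blowUp B (2 * n * s) with hS_def
  have hcard : (S.card : ℝ) * 2 ^ (-(r + n * δ)) < ε := by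
    have h1 : (B.card : ℝ) ≤ 2 ^ r := card_likely_le
      (outDist_nonneg hP (W.pn_nonneg n)) (sum_outDist_univ hP1 (W.sum_pn n)) r
    calc (S.card : ℝ) * 2 ^ (-(r + n * δ))
        ≤ 2 ^ r * 2 ^ (n * ((1 + q) * s * L)) * 2 ^ (-(r + n * δ)) := by
          gcongr
          exact (card_blowUp_sqrt_le B hα0 hα4).trans (by gcongr)
      _ = 2 ^ (-(n * (s * L * (q + 1)))) := by
          rw [← Real.rpow_add two_pos, ← Real.rpow_add two_pos, hδ_def]
          congr 1
          ring
      _ < ε := by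
          refine Real.rpow_lt_rpow_of_exponent_lt one_lt_two ?_
          rw [neg_mul, neg_lt_neg_iff]
          refine mul_lt_mul_of_pos_left ?_ hn0
          rw [← hss, mul_assoc]
          refine mul_lt_mul_of_pos_left ?_ hs0
          nlinarith
  have hw : T / K ≤ n * δ := by
    rw [div_le_iff₀ hK0]
    have h1 : 2 * q ≤ (2 * (q : ℝ) + 2) * L / 2 := by nlinarith
    calc T ≤ n * (2 * Real.logb 2 q) * 1 := by linarith
      _ ≤ n * ((2 * (q : ℝ) + 2) * L / 2) * (2 * s * K) := by
          gcongr
          linarith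
      _ = n * δ * K := by
          rw [hδ_def]
          ring
  exact cpr_spectrum_deviation_lt hOut hPX hM hu hA hw
    (fun x hx => imgMass_compl_blowUp_le W n x B hα0.le (hAup x hx)) hAlow hcard

end Paper
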